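/- Suppose the input maps X^in(i,j), 1 ≤ i < j ≤ n, are generated according to the random corruption model, and let α, β be parameters independent of n and d with 0 < α ≤ β ≤ 2. Assume p_true ≥ β/(α+β), p_true²/β + (1/α − 1/β)p_true + (1/2 − 1/α) > 0, p_true ≥ 1/4, n² > 12d, and d = d(n) satisfies d(n)⁴ log(n)/n → 0. Then with probability tending to 1 as n → ∞, conditions (C4) and (C5) hold strictly: for all t,q ∈ [d] and all 1 ≤ i < j ≤ n, if a_tt(i,j) = 1, a_qq(i,j) = −1, a_tq(i,j) = 1 then κ_q(i,j) + δ_{t→q}^{i→j} + δ_{q→t}^{j→i} > 0, and if a_tt(i,j) = −1, a_qq(i,j) = 1, a_tq(i,j) = 1 then κ_t(i,j) + δ_{t→q}^{i→j} + δ_{q→t}^{j→i} > 0. -/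

import Mathlib

open Matrix
open scoped Classical

noncomputable section

/-- The permutation matrix of a permutation `σ` of `Fin d`. -/
def permMat (d : ℕ) (σ : Equiv.Perm (Fin d)) : Matrix (Fin d) (Fin d) ℝ :=
  Matrix.of fun t q => if σ q = t then 1 else 0

/-- The objective function of the basic LP (P):
`∑_{i<j} ∑_{t,q} a_{tq}(i,j) X_{tq}(i,j)`. -/
def lpObj (n d : ℕ) (a X : Fin n → Fin n → Matrix (Fin d) (Fin d) ℝ) : ℝ :=
  ∑ p ∈ Finset.univ.filter (fun p : Fin n × Fin n => p.1 < p.2),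
    ∑ t : Fin d, ∑ q : Fin d, a p.1 p.2 t q * X p.1 p.2 t q

/-- The feasible region of the basic LP (P): all row and column sums equal one,
the triangle inequalities hold, and all entries are nonnegative. -/
def lpFeasible (n d : ℕ) (X : Fin n → Fin n → Matrix (Fin d) (Fin d) ℝ) : Prop :=
  (∀ i j : Fin n, i < j → ∀ t : Fin d, ∑ q : Fin d, X i j t q = 1) ∧
  (∀ i j : Fin n, i < j → ∀ q : Fin d, ∑ t : Fin d, X i j t q = 1) ∧
  (∀ i j k : Fin n, i < j → j < k → ∀ l t q : Fin d,
      X i j l t + X j k t q - X i k l q ≤ 1 ∧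
      X i j l t - X j k t q + X i k l q ≤ 1 ∧
      - X i j l t + X j k t q + X i k l q ≤ 1) ∧
  (∀ i j : Fin n, i < j → ∀ t q : Fin d, 0 ≤ X i j t q)

/-- The quantity `δ_{t→q}^{i→j}` of the dual certificate. -/
def deltaJOM (n d : ℕ) (a : Fin n → Fin n → Matrix (Fin d) (Fin d) ℝ) (α β : ℝ)
    (i j : Fin n) (t q : Fin d) : ℝ :=
  (1 / (n : ℝ)) *
    ∑ k ∈ Finset.univ.filter (fun k : Fin n => k ≠ i ∧ k ≠ j ∧ a k i t t = -1),
      ((a k j t q - a i j t q) / α + (a i j t t - a k j t t) / (β * d))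

/-- The quantity `κ_t(i,j)` of the dual certificate. -/
def kappaJOM (n d : ℕ) (a : Fin n → Fin n → Matrix (Fin d) (Fin d) ℝ) (α β : ℝ)
    (i j : Fin n) (t : Fin d) : ℝ :=
  (1 / (n : ℝ)) *
      ∑ l ∈ Finset.univ.filter (fun l : Fin d => l ≠ t),
        ∑ k ∈ Finset.univ.filter (fun k : Fin n => k ≠ i ∧ k ≠ j),
          min (a k i l t / α + a k j t t / (β * d)) (a k j l t / α + a k i t t / (β * d))
    + (1 / (n : ℝ)) * (1 / (2 * α) - ((d : ℝ) - 1) / (2 * β * d)) *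
        ((∑ k ∈ Finset.univ.filter (fun k : Fin n => k ≠ i), a k i t t) +
          ∑ k ∈ Finset.univ.filter (fun k : Fin n => k ≠ j), a k j t t)
    - ((d : ℝ) - 2) / α + 1
    + (1 / (2 * (n : ℝ))) *
        ∑ l ∈ Finset.univ.filter (fun l : Fin d => l ≠ t),
          ((a i j t l + a j i t l) / α + 2 * a i j t t / (β * d))

/-- A sample of the random corruption model: for each (ordered) pair of objects, a
Bernoulli coin and a uniformly random permutation. -/
abbrev Sample (n d : ℕ) := Fin n → Fin n → Bool × Equiv.Perm (Fin d)

/-- The probability weight of a sample: each coin is heads with probability `p`, each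
permutation is uniform among the `d!` permutations, all independently. -/
def wtJOM (n d : ℕ) (p : ℝ) (ω : Sample n d) : ℝ :=
  ∏ i : Fin n, ∏ j : Fin n,
    ((if (ω i j).1 then p else 1 - p) / (Nat.factorial d : ℝ))

/-- The probability of an event under the random corruption model. -/
def prJOM (n d : ℕ) (p : ℝ) (E : Sample n d → Prop) : ℝ :=
  ∑ ω : Sample n d, if E ω then wtJOM n d p ω else 0

/-- The random input map for a pair `i < j`: the identity (ground truth) if the coin
shows heads, and an independent uniformly random permutation matrix otherwise. -/
def baseMat (n d : ℕ) (ω : Sample n d) (i j : Fin n) : Matrix (Fin d) (Fin d) ℝ :=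
  if (ω i j).1 then 1 else permMat d (ω i j).2

/-- The full collection of random input maps, extended by transposition:
`X^in(j,i) = X^in(i,j)ᵀ`. -/
def XinRand (n d : ℕ) (ω : Sample n d) (i j : Fin n) : Matrix (Fin d) (Fin d) ℝ :=
  if i < j then baseMat n d ω i j else if j < i then (baseMat n d ω j i)ᵀ else 1

/-- The random coefficients `a_{tq}(i,j) = 1 - 2 X^in_{tq}(i,j)`. -/
def aRand (n d : ℕ) (ω : Sample n d) (i j : Fin n) : Matrix (Fin d) (Fin d) ℝ :=
  Matrix.of fun t q => 1 - 2 * XinRand n d ω i j t q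

/-- Single-edge weight. -/
def wE (d : ℕ) (p : ℝ) (x : Bool × Equiv.Perm (Fin d)) : ℝ :=
  (if x.1 then p else 1 - p) / (Nat.factorial d : ℝ)

lemma wE_nonneg (d : ℕ) (p : ℝ) (hp0 : 0 ≤ p) (hp1 : p ≤ 1) (x) : 0 ≤ wE d p x := by
  unfold wE
  apply div_nonneg _ (by positivity)
  split_ifs <;> linarith

lemma wE_sum (d : ℕ) (p : ℝ) : ∑ x, wE d p x = 1 := by
  unfold wE
  rw [Fintype.sum_prod_type]
  have h : (Nat.factorial d : ℝ) ≠ 0 := by positivity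
  simp [Fintype.card_perm]
  field_simp
  ring

/-- Single-edge matrix. -/
def bm (d : ℕ) (x : Bool × Equiv.Perm (Fin d)) : Matrix (Fin d) (Fin d) ℝ :=
  if x.1 then 1 else permMat d x.2

lemma perm_sum (d : ℕ) (a b : Fin d) :
    ∑ σ : Equiv.Perm (Fin d), (if σ b = a then (1:ℝ) else 0) = (Nat.factorial d : ℝ) / d := by
  have h1 : ∀ a', ∑ σ : Equiv.Perm (Fin d), (if σ b = a' then (1:ℝ) else 0)
      = ∑ σ : Equiv.Perm (Fin d), (if σ b = a then (1:ℝ) else 0) := by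
    intro a'
    refine Fintype.sum_equiv (Equiv.mulLeft (Equiv.swap a a')) _ _ ?_
    intro σ
    have : (Equiv.swap a a') (σ b) = a ↔ σ b = a' := by
      rw [Equiv.swap_apply_eq_iff, Equiv.swap_apply_left]
    simp [this]
  have h2 : ∑ a', ∑ σ : Equiv.Perm (Fin d), (if σ b = a' then (1:ℝ) else 0)
      = (Nat.factorial d : ℝ) := by
    rw [Finset.sum_comm]
    simp [Fintype.card_perm]
  rw [Finset.sum_congr rfl (fun a' _ => h1 a')] at h2
  simp only [Finset.sum_const, Finset.card_univ, Fintype.card_fin, nsmul_eq_mul] at h2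
  have hd : (d : ℝ) ≠ 0 := by
    have := a.pos
    positivity
  field_simp
  linarith

/-- Mean of an entry. -/
def mE (d : ℕ) (p : ℝ) (a b : Fin d) : ℝ := (if a = b then p else 0) + (1 - p) / d

lemma bm_mean (d : ℕ) (p : ℝ) (a b : Fin d) :
    ∑ x, wE d p x * bm d x a b = mE d p a b := by
  have h : (Nat.factorial d : ℝ) ≠ 0 := by positivity
  have hd : (d : ℝ) ≠ 0 := by
    have := a.pos
    positivity
  unfold wE bm mE
  rw [Fintype.sum_prod_type]
  simp only [Fintype.sum_bool, if_true, Bool.false_eq_true, if_false, permMat, Matrix.of_apply]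
  rw [← Finset.mul_sum, ← Finset.mul_sum, perm_sum, Matrix.one_apply]
  simp [Fintype.card_perm]
  split_ifs <;> field_simp

lemma mE_symm (d : ℕ) (p : ℝ) (a b : Fin d) : mE d p a b = mE d p b a := by
  unfold mE; simp [eq_comm]

lemma bm_01 (d : ℕ) (x) (a b : Fin d) : bm d x a b = 0 ∨ bm d x a b = 1 := by
  unfold bm permMat
  split_ifs
  · rw [Matrix.one_apply]; split_ifs <;> simp
  · rw [Matrix.of_apply]; split_ifs <;> simp

lemma bm_row (d : ℕ) (x) (a : Fin d) : ∑ b, bm d x a b = 1 := by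
  unfold bm permMat
  split_ifs
  · simp [Matrix.one_apply]
  · have : ∀ b, (x.2 b = a ↔ b = x.2.symm a) := fun b => by rw [Equiv.eq_symm_apply]
    simp [this]

lemma bm_col (d : ℕ) (x) (b : Fin d) : ∑ a, bm d x a b = 1 := by
  unfold bm permMat
  split_ifs
  · simp [Matrix.one_apply]
  · simp

/-- factorization -/
lemma prod_expect {ι Ω : Type*} [Fintype ι] [DecidableEq ι] [Fintype Ω]
    (w : Ω → ℝ) (f : ι → ι → Ω → ℝ) :
    ∑ ω : ι → ι → Ω, (∏ i, ∏ j, w (ω i j)) * ∏ i, ∏ j, f i j (ω i j)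
      = ∏ i, ∏ j, ∑ x, w x * f i j x := by
  have h : ∀ i, ∏ j, ∑ x, w x * f i j x = ∑ ρ : ι → Ω, ∏ j, w (ρ j) * f i j (ρ j) := by
    intro i
    rw [Finset.prod_univ_sum, Fintype.piFinset_univ]
  simp_rw [h]
  rw [Finset.prod_univ_sum, Fintype.piFinset_univ]
  simp_rw [Finset.prod_mul_distrib]

lemma prod_expect_inj {ι Ω κ : Type*} [Fintype ι] [DecidableEq ι] [Fintype Ω]
    (w : Ω → ℝ) (hw : ∑ x, w x = 1) (S : Finset κ) (e : κ → ι × ι)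
    (he : Set.InjOn e S) (g : κ → Ω → ℝ) :
    ∑ ω : ι → ι → Ω, (∏ i, ∏ j, w (ω i j)) * ∏ x ∈ S, g x (ω (e x).1 (e x).2)
      = ∏ x ∈ S, ∑ y, w y * g x y := by
  have h1 : ∀ ω : ι → ι → Ω, ∏ x ∈ S, g x (ω (e x).1 (e x).2)
      = ∏ i, ∏ j, ∏ x ∈ S with e x = (i, j), g x (ω i j) := by
    intro ω
    rw [← Fintype.prod_prod_type' (f := fun i j => ∏ x ∈ S with e x = (i, j), g x (ω i j)),
      ← Finset.prod_fiberwise S e]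
    refine Finset.prod_congr rfl fun ij _ => ?_
    refine Finset.prod_congr rfl fun x hx => ?_
    rw [Finset.mem_filter] at hx
    rw [hx.2]
  simp_rw [h1]
  rw [prod_expect w (fun i j y => ∏ x ∈ S with e x = (i, j), g x y)]
  rw [← Fintype.prod_prod_type'
    (f := fun i j => ∑ y, w y * ∏ x ∈ S with e x = (i, j), g x y), ← Finset.prod_fiberwise S e]
  refine Finset.prod_congr rfl fun ij _ => ?_
  have hc : (S.filter (fun x => e x = ij)).card ≤ 1 := by
    rw [Finset.card_le_one]
    intro a ha b hb
    rw [Finset.mem_filter] at ha hb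
    exact he ha.1 hb.1 (ha.2.trans hb.2.symm)
  rcases Nat.le_one_iff_eq_zero_or_eq_one.mp hc with h | h
  · rw [Finset.card_eq_zero] at h
    simp [h, hw]
  · obtain ⟨a, ha⟩ := Finset.card_eq_one.mp h
    simp [ha]

/-- Deterministic arithmetic on the means. -/
lemma mean_ineq (p α β e : ℝ) (hp1 : p ≤ 1) (hα : 0 < α) (hαβ : α ≤ β)
    (he : 0 ≤ e) (hA1 : β / (α + β) ≤ p) :
    2 * (p ^ 2 / β + (1 / α - 1 / β) * p + (1 / 2 - 1 / α)) ≤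
      1 - 2 / α + 2 * (1 / α - (1 - e) / β) * (p + (1 - p) * e)
       + 2 * ((1 - e) / β) * (p + (1 - p) * e) ^ 2
       - 4 * (p + (1 - p) * e) * ((1 - p) * e) / α
       + 4 * (p + (1 - p) * e) ^ 2 * (e / β) - 2 * (p + (1 - p) * e) * (e / β) := by
  have hβ : 0 < β := lt_of_lt_of_le hα hαβ
  have h1 : (1 - p) / α ≤ p / β := by
    rw [div_le_iff₀ (by linarith)] at hA1
    rw [div_le_div_iff₀ hα hβ]
    nlinarith
  have hp : 1 / 2 ≤ p := by
    refine le_trans ?_ hA1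
    rw [div_le_div_iff₀ (by norm_num) (by linarith)]
    linarith
  obtain ⟨r, hr⟩ : ∃ r, r = 1 - p := ⟨_, rfl⟩
  obtain ⟨A, hA⟩ : ∃ A, A = 1 / α := ⟨_, rfl⟩
  obtain ⟨B, hB⟩ : ∃ B, B = 1 / β := ⟨_, rfl⟩
  have hB0 : 0 ≤ B := by rw [hB]; positivity
  have h1' : r * A ≤ p * B := by
    rw [hr, hA, hB, mul_one_div, mul_one_div]; exact h1
  have hr0 : 0 ≤ r := by linarith
  have key : 0 ≤ 2 * e * ((p * B - r * A) * (2 * p - 1 + 2 * r * e)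
      + B * (r * (3 * p - 1) + r * e * r + r ^ 2 * e ^ 2)) := by
    have : 0 ≤ p * B - r * A := by linarith
    have : 0 ≤ 2 * p - 1 + 2 * r * e := by nlinarith [mul_nonneg hr0 he]
    have : 0 ≤ 3 * p - 1 := by linarith
    positivity
  have hpr : p = 1 - r := by linarith
  simp only [div_eq_mul_inv] at *
  rw [one_mul] at hA hB
  rw [← hA, ← hB, ← sub_nonneg]
  refine le_trans key (le_of_eq ?_)
  rw [hpr]
  ring

lemma fin_arith (n d A g b U V W D1 D2 D3 P r M ε : ℝ) (hA0 : 0 < A) (hb0 : 0 ≤ b) (hg0 : 0 ≤ g)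
    (hgb : g + b ≤ A) (hn0 : 0 < n) (hdR : 2 ≤ d) (hdn : d ≤ ε * n) (hεM : 15 * ε * A < M)
    (hmain : M ≤ 1 - 2 * A + 2 * (A - g) * P + 2 * g * P ^ 2 - 4 * P * r * A
      + 4 * P ^ 2 * b - 2 * P * b)
    (bU : -(ε * n) ≤ U - n * P ∧ U - n * P ≤ ε * n)
    (bV : -(ε * n) ≤ V - n * P ∧ V - n * P ≤ ε * n)
    (bW : -(ε * n) ≤ W - n * (P * P) ∧ W - n * (P * P) ≤ ε * n)
    (bD1 : -(ε * n) ≤ D1 - n * (P * r) ∧ D1 - n * (P * r) ≤ ε * n)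
    (bD2 : -(ε * n) ≤ D2 - n * (P * P) ∧ D2 - n * (P * P) ≤ ε * n)
    (bD3 : -(ε * n) ≤ D3 - n * (r * P) ∧ D3 - n * (r * P) ≤ ε * n) :
    0 < n * (1 - 2 * A) - (d - 6) * A + (A - g) * (U + V) + 2 * g * W
      - 2 * A * D1 + 2 * b * D2 - 2 * A * D3 - 2 * b * V + 2 * b * W := by
  have hAg : 0 ≤ A - g := by linarith
  have z1 := mul_le_mul_of_nonneg_left bU.1 hAg
  have z2 := mul_le_mul_of_nonneg_left bV.1 hAg
  have z3 := mul_le_mul_of_nonneg_left bW.1 hg0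
  have z4 := mul_le_mul_of_nonneg_left bD1.2 hA0.le
  have z5 := mul_le_mul_of_nonneg_left bD2.1 hb0
  have z6 := mul_le_mul_of_nonneg_left bD3.2 hA0.le
  have z7 := mul_le_mul_of_nonneg_left bV.2 hb0
  have z8 := mul_le_mul_of_nonneg_left bW.1 hb0
  have z9 := mul_le_mul_of_nonneg_left hdn hA0.le
  have z10 := mul_le_mul_of_nonneg_left hmain hn0.le
  have z11 := mul_lt_mul_of_pos_left hεM hn0
  have hεn : 0 ≤ ε * n := by linarith
  have z12 := mul_le_mul_of_nonneg_left hgb hεn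
  have z13 := mul_nonneg hεn hb0
  have z14 := mul_nonneg hεn hg0
  have z15 := mul_nonneg hεn hA0.le
  linarith

lemma det_lemma (n d : ℕ) (hn : 2 ≤ n) (hd : 2 ≤ d) (X : Fin n → Fin n → Matrix (Fin d) (Fin d) ℝ)
    (a : Fin n → Fin n → Matrix (Fin d) (Fin d) ℝ)
    (ha : ∀ i j t q, a i j t q = 1 - 2 * X i j t q)
    (h01 : ∀ i j t q, X i j t q = 0 ∨ X i j t q = 1)
    (hrow : ∀ i j t, ∑ q, X i j t q = 1)
    (hcol : ∀ i j q, ∑ t, X i j t q = 1)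
    (hsym : ∀ i j t q, X j i t q = X i j q t)
    (p α β ε : ℝ) (hp1 : p ≤ 1) (hα : 0 < α) (hαβ : α ≤ β)
    (hA1 : β / (α + β) ≤ p)
    (hε : 15 * ε < α * (2 * (p ^ 2 / β + (1 / α - 1 / β) * p + (1 / 2 - 1 / α))))
    (hdn : (d : ℝ) ≤ ε * n)
    (i j : Fin n) (hij : i ≠ j)
    (hS : ∀ i j : Fin n, i ≠ j → ∀ a b : Fin d,
      |∑ k with k ≠ i ∧ k ≠ j, X k i a b - n * mE d p a b| ≤ ε * n)
    (hD : ∀ i j : Fin n, i ≠ j → ∀ a b c e : Fin d,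
      |∑ k with k ≠ i ∧ k ≠ j, X k i a b * X k j c e - n * (mE d p a b * mE d p c e)| ≤ ε * n)
    (t q : Fin d) (h1 : X i j t t = 0) (h2 : X i j q q = 1) :
    0 < kappaJOM n d a α β i j q + deltaJOM n d a α β i j t q + deltaJOM n d a α β j i q t := by
  have hβ : 0 < β := lt_of_lt_of_le hα hαβ
  have htq : t ≠ q := by rintro rfl; rw [h1] at h2; norm_num at h2
  have hnR : (2 : ℝ) ≤ n := by exact_mod_cast hn
  have hdR : (2 : ℝ) ≤ d := by exact_mod_cast hd
  have hn0 : (0 : ℝ) < n := by linarith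
  have hd0 : (0 : ℝ) < d := by linarith
  have hx0 : ∀ i j t q, 0 ≤ X i j t q := fun i j t q => by rcases h01 i j t q with h | h <;> rw [h] <;> norm_num
  have hx1 : ∀ i j t q, X i j t q ≤ 1 := fun i j t q => by rcases h01 i j t q with h | h <;> rw [h] <;> norm_num
  -- off-diagonal zeros in row q and column q
  have hcol' : ∀ i j q, ∑ l with l ≠ q, X i j l q = 1 - X i j q q := by
    intro i j q
    rw [← hcol i j q, Finset.filter_ne', ← Finset.add_sum_erase _ _ (Finset.mem_univ q)]; ring
  have hrow' : ∀ i j q, ∑ l with l ≠ q, X i j q l = 1 - X i j q q := by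
    intro i j q
    rw [← hrow i j q, Finset.filter_ne', ← Finset.add_sum_erase _ _ (Finset.mem_univ q)]; ring
  have htq0 : X i j t q = 0 := by
    have hz := hcol' i j q
    rw [h2, sub_self, Finset.sum_eq_zero_iff_of_nonneg (fun l _ => hx0 i j l q)] at hz
    exact hz t (by simp [htq])
  have cardl : ((Finset.univ.filter (fun l : Fin d => l ≠ q)).card : ℝ) = d - 1 := by
    rw [Finset.filter_ne', Finset.card_erase_of_mem (Finset.mem_univ q), Finset.card_univ,
      Fintype.card_fin, Nat.cast_sub (by omega)]; simp
  set K := Finset.univ.filter (fun k : Fin n => k ≠ i ∧ k ≠ j) with hK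
  have hKe : K = (Finset.univ.erase i).erase j := by
    ext k; simp [hK]; tauto
  have hji : j ∈ (Finset.univ : Finset (Fin n)).erase i := by simp [hij.symm]
  have cardK : (K.card : ℝ) = n - 2 := by
    rw [hKe, Finset.card_erase_of_mem hji, Finset.card_erase_of_mem (Finset.mem_univ i),
      Finset.card_univ, Fintype.card_fin, Nat.sub_sub, Nat.cast_sub (by omega)]; norm_num
  have hK' : Finset.univ.filter (fun k : Fin n => k ≠ j ∧ k ≠ i) = K := by
    ext k; simp [hK]; tauto
  set U := ∑ k ∈ K, X k i q q with hU
  set V := ∑ k ∈ K, X k j q q with hV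
  set W := ∑ k ∈ K, X k i q q * X k j q q with hW
  set D1 := ∑ k ∈ K, X k i t t * X k j t q with hD1
  set D2 := ∑ k ∈ K, X k i t t * X k j t t with hD2
  set D3 := ∑ k ∈ K, X k i q t * X k j q q with hD3
  set b := 1 / (β * d) with hb
  set A := 1 / α with hAdef
  have hb0 : 0 ≤ b := by positivity
  have hA0 : 0 < A := by positivity
  -- first sum of kappa
  have hmin : ∀ k l, (A + b) - 2 * ((X k i l q + X k j l q) * A
        + b * (X k i q q + X k j q q - X k i q q * X k j q q)) ≤
      min (a k i l q / α + a k j q q / (β * d)) (a k j l q / α + a k i q q / (β * d)) := by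
    intro k l
    have e1 : ∀ x, x / α = x * A := fun x => by rw [hAdef]; ring
    have e2 : ∀ x, x / (β * d) = x * b := fun x => by rw [hb]; ring
    rw [e1, e1, e2, e2, ha, ha, ha, ha]
    have p1 := mul_nonneg hb0 (mul_nonneg (hx0 k i q q) (sub_nonneg.2 (hx1 k j q q)))
    have p2 := mul_nonneg hb0 (mul_nonneg (hx0 k j q q) (sub_nonneg.2 (hx1 k i q q)))
    have p3 := mul_nonneg hA0.le (hx0 k i l q)
    have p4 := mul_nonneg hA0.le (hx0 k j l q)
    apply le_min <;> nlinarith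
  have T1 : ∑ l with l ≠ q, ∑ k ∈ K, ((A + b) - 2 * ((X k i l q + X k j l q) * A
        + b * (X k i q q + X k j q q - X k i q q * X k j q q)))
      = (n - 2) * ((d - 1) * (A + b) - 4 * A) + 2 * A * (U + V) - 2 * (d - 1) * b * (U + V - W) := by
    rw [Finset.sum_comm]
    have : ∀ k ∈ K, ∑ l with l ≠ q, ((A + b) - 2 * ((X k i l q + X k j l q) * A
        + b * (X k i q q + X k j q q - X k i q q * X k j q q))) =
        ((d - 1) * (A + b) - 4 * A) + 2 * A * X k i q q + 2 * A * X k j q q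
         - 2 * (d - 1) * b * X k i q q - 2 * (d - 1) * b * X k j q q
         + 2 * (d - 1) * b * (X k i q q * X k j q q) := by
      intro k _
      simp only [Finset.sum_sub_distrib, Finset.sum_add_distrib, ← Finset.mul_sum,
        ← Finset.sum_mul, hcol', Finset.sum_const, nsmul_eq_mul, cardl]
      ring
    rw [Finset.sum_congr rfl this]
    simp only [Finset.sum_add_distrib, Finset.sum_sub_distrib, ← Finset.mul_sum, Finset.sum_const,
      nsmul_eq_mul, cardK]
    ring
  have T1' : (n - 2) * ((d - 1) * (A + b) - 4 * A) + 2 * A * (U + V) - 2 * (d - 1) * b * (U + V - W)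
     ≤ ∑ l with l ≠ q, ∑ k ∈ K,
      min (a k i l q / α + a k j q q / (β * d)) (a k j l q / α + a k i q q / (β * d)) := by
    rw [← T1]
    exact Finset.sum_le_sum fun l _ => Finset.sum_le_sum fun k _ => hmin k l
  have T2 : ∑ k with k ≠ i, a k i q q = (n - 2) - 2 * U - 1 := by
    rw [Finset.filter_ne', ← Finset.add_sum_erase _ _ hji, ← hKe]
    simp only [ha, Finset.sum_sub_distrib, ← Finset.mul_sum, Finset.sum_const,
      nsmul_eq_mul, cardK]
    rw [hsym i j, h2]; ring
  have T3 : ∑ k with k ≠ j, a k j q q = (n - 2) - 2 * V - 1 := by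
    have : K = (Finset.univ.erase j).erase i := by
      ext k; simp [hK]
    rw [Finset.filter_ne', ← Finset.add_sum_erase (Finset.univ.erase j) _
      (show i ∈ _ by simp [hij]), ← this]
    simp only [ha, Finset.sum_sub_distrib, ← Finset.mul_sum, Finset.sum_const,
      nsmul_eq_mul, cardK]
    rw [h2]; ring
  have T4 : ∑ l with l ≠ q, ((a i j q l + a j i q l) / α + 2 * a i j q q / (β * d))
      = (d - 1) * (2 * A - 2 * b) := by
    have : ∀ l ∈ Finset.univ.filter (fun l : Fin d => l ≠ q),
        ((a i j q l + a j i q l) / α + 2 * a i j q q / (β * d)) =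
        (2 * A - 2 * b) - 2 * A * X i j q l - 2 * A * X i j l q := by
      intro l _
      rw [ha, ha, ha, hsym i j, h2, hb, hAdef]; ring
    rw [Finset.sum_congr rfl this]
    simp only [Finset.sum_sub_distrib, ← Finset.mul_sum, Finset.sum_const, nsmul_eq_mul, cardl]
    rw [hrow', hcol', h2]; ring
  have T5 : deltaJOM n d a α β i j t q = (1 / n) * (-2 * A * D1 + 2 * b * D2) := by
    unfold deltaJOM
    congr 1
    have hf : Finset.univ.filter (fun k : Fin n => k ≠ i ∧ k ≠ j ∧ a k i t t = -1)
       = K.filter (fun k => X k i t t = 1) := by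
      ext k
      simp only [hK, Finset.mem_filter, Finset.mem_univ, true_and, ha, and_assoc]
      have : (1 - 2 * X k i t t = -1) ↔ X k i t t = 1 := by
        constructor <;> intro h <;> linarith
      rw [this]
    rw [hf, Finset.sum_filter]
    have : ∀ k ∈ K, (if X k i t t = 1 then ((a k j t q - a i j t q) / α + (a i j t t - a k j t t) / (β * d)) else 0)
        = -2 * A * (X k i t t * X k j t q) + 2 * b * (X k i t t * X k j t t) := by
      intro k _
      rw [ha, ha, ha, ha, h1, htq0, hb, hAdef]
      rcases h01 k i t t with h | h
      · simp [h]
      · rw [if_pos h, h]; ring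
    rw [Finset.sum_congr rfl this]
    simp only [Finset.sum_add_distrib, ← Finset.mul_sum, hD1, hD2]
  have T6 : deltaJOM n d a α β j i q t = (1 / n) * (-2 * A * D3 - 2 * b * V + 2 * b * W) := by
    unfold deltaJOM
    congr 1
    have hf : Finset.univ.filter (fun k : Fin n => k ≠ j ∧ k ≠ i ∧ a k j q q = -1)
       = K.filter (fun k => X k j q q = 1) := by
      ext k
      simp only [hK, Finset.mem_filter, Finset.mem_univ, true_and, ha, and_assoc]
      have : (1 - 2 * X k j q q = -1) ↔ X k j q q = 1 := by
        constructor <;> intro h <;> linarith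
      rw [this]; tauto
    rw [hf, Finset.sum_filter]
    have : ∀ k ∈ K, (if X k j q q = 1 then ((a k i q t - a j i q t) / α + (a j i q q - a k i q q) / (β * d)) else 0)
        = -2 * A * (X k i q t * X k j q q) - 2 * b * X k j q q
          + 2 * b * (X k i q q * X k j q q) := by
      intro k _
      rw [ha, ha, ha, ha, hsym i j, hsym i j, h2, htq0, hb, hAdef]
      rcases h01 k j q q with h | h
      · simp [h]
      · rw [if_pos h, h]; ring
    rw [Finset.sum_congr rfl this]
    simp only [Finset.sum_add_distrib, Finset.sum_sub_distrib, ← Finset.mul_sum, hD3, hV, hW]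
  -- probabilistic estimates
  set P := p + (1 - p) * (1 / d) with hP
  set r := (1 - p) * (1 / d) with hr
  have mqq : ∀ s : Fin d, mE d p s s = P := fun s => by simp [mE, hP]; ring
  have mtq : mE d p t q = r := by simp [mE, htq, hr]; ring
  have mqt : mE d p q t = r := by simp [mE, htq.symm, hr]; ring
  have bU := abs_le.1 (hS i j hij q q)
  have bV := abs_le.1 (hS j i hij.symm q q)
  have bW := abs_le.1 (hD i j hij q q q q)
  have bD1 := abs_le.1 (hD i j hij t t t q)
  have bD2 := abs_le.1 (hD i j hij t t t t)
  have bD3 := abs_le.1 (hD i j hij q t q q)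
  rw [hK', mqq] at bV
  rw [mqq] at bU
  rw [mqq] at bW
  rw [mqq, mtq] at bD1
  rw [mqq] at bD2
  rw [mqq, mqt] at bD3
  have main := mean_ineq p α β (1 / d) hp1 hα hαβ (by positivity) hA1
  rw [← hr, ← hP] at main
  set M := 2 * (p ^ 2 / β + (1 / α - 1 / β) * p + (1 / 2 - 1 / α)) with hM
  have hbb : (1 / d : ℝ) / β = b := by rw [hb]; field_simp
  set g := ((d : ℝ) - 1) * b with hg
  have hgg : (1 - 1 / (d : ℝ)) / β = g := by rw [hg, hb]; field_simp
  rw [hbb, hgg] at main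
  have hg0 : 0 ≤ g := mul_nonneg (by linarith) hb0
  have hgb : g + b ≤ A := by
    have : g + b = 1 / β := by rw [hg, hb]; field_simp; ring
    rw [this]; exact one_div_le_one_div_of_le hα hαβ
  have hεM : 15 * ε * A < M := by
    have : M = (α * M) * A := by rw [hAdef]; field_simp
    rw [this]; exact mul_lt_mul_of_pos_right hε hA0
  have hmain : M ≤ 1 - 2 * A + 2 * (A - g) * P + 2 * g * P ^ 2 - 4 * P * r * A
      + 4 * P ^ 2 * b - 2 * P * b := by
    refine main.trans (le_of_eq ?_)
    rw [hAdef]; ring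
  -- lower bound
  have hk : (1 / n) * ((n - 2) * ((d - 1) * (A + b) - 4 * A) + 2 * A * (U + V)
        - 2 * (d - 1) * b * (U + V - W))
      + (1 / n) * (A / 2 - g / 2) * (((n - 2) - 2 * U - 1) + ((n - 2) - 2 * V - 1))
      - (d - 2) * A + 1 + (1 / (2 * n)) * ((d - 1) * (2 * A - 2 * b)) ≤ kappaJOM n d a α β i j q := by
    unfold kappaJOM
    rw [T2, T3, T4]
    have e1 : (1 / (2 * α) - ((d : ℝ) - 1) / (2 * β * d)) = A / 2 - g / 2 := by
      rw [hg, hb, hAdef]; field_simp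
    have e2 : ((d : ℝ) - 2) / α = (d - 2) * A := by rw [hAdef]; ring
    rw [e1, e2]
    have := mul_le_mul_of_nonneg_left T1' (show 0 ≤ 1 / (n : ℝ) by positivity)
    linarith
  rw [T5, T6]
  refine lt_of_lt_of_le ?_ (add_le_add_left (add_le_add_left hk _) _)
  have hfin : 0 < n * (1 - 2 * A) - (d - 6) * A + (A - g) * (U + V) + 2 * g * W
      - 2 * A * D1 + 2 * b * D2 - 2 * A * D3 - 2 * b * V + 2 * b * W := by
    exact fin_arith _ _ _ _ _ _ _ _ _ _ _ _ _ _ _ hA0 hb0 hg0 hgb hn0 hdR hdn hεM hmain bU bV bW bD1 bD2 bD3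
  have : 0 < (1 / (n : ℝ)) * (n * (1 - 2 * A) - (d - 6) * A + (A - g) * (U + V) + 2 * g * W
      - 2 * A * D1 + 2 * b * D2 - 2 * A * D3 - 2 * b * V + 2 * b * W) := by positivity
  refine lt_of_lt_of_eq this ?_
  rw [hg]
  clear_value U V W D1 D2 D3 M P r b A K
  field_simp
  ring

/-- The unordered edge as an increasing pair. -/
def edg {n : ℕ} (k i : Fin n) : Fin n × Fin n := (min k i, max k i)

lemma edg_inj {n : ℕ} {i j : Fin n} (hij : i ≠ j) (T : Finset (Fin n))
    (hT : ∀ k ∈ T, k ≠ i ∧ k ≠ j) :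
    Set.InjOn (fun x : Fin n × Bool => edg x.1 (if x.2 then i else j))
      (T ×ˢ (Finset.univ : Finset Bool) : Finset (Fin n × Bool)) := by
  rintro ⟨k, b⟩ hk ⟨k', b'⟩ hk' h
  simp only [Finset.coe_product, Set.mem_prod, Finset.mem_coe] at hk hk'
  have h1 := hT k hk.1
  have h2 := hT k' hk'.1
  simp only [edg, Prod.mk.injEq] at h
  have e : ∀ {i j : Fin n}, i ≠ j ↔ i.val ≠ j.val := fun {i j} => by rw [Ne, Fin.ext_iff]
  rw [e] at hij
  rw [e, e] at h1 h2
  rw [Fin.ext_iff, Fin.ext_iff] at h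
  simp only [Fin.coe_min, Fin.coe_max] at h
  rw [Prod.mk.injEq, Fin.ext_iff]
  cases b <;> cases b' <;> simp at h ⊢ <;> omega

lemma mgf_eq (n d : ℕ) (p : ℝ) (i j : Fin n) (hij : i ≠ j)
    (A B : Fin n → Bool × Equiv.Perm (Fin d) → ℝ)
    (hA : ∀ k x, A k x = 0 ∨ A k x = 1) (hB : ∀ k x, B k x = 0 ∨ B k x = 1)
    (x y : ℝ) (K : Finset (Fin n)) (hK : ∀ k ∈ K, k ≠ i ∧ k ≠ j)
    (hx : ∀ k ∈ K, ∑ z, wE d p z * A k z = x) (hy : ∀ k ∈ K, ∑ z, wE d p z * B k z = y) (s : ℝ) :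
    ∑ ω : Sample n d, wtJOM n d p ω * Real.exp (s * ∑ k ∈ K,
      A k (ω (edg k i).1 (edg k i).2) * B k (ω (edg k j).1 (edg k j).2))
      = (1 + (Real.exp s - 1) * (x * y)) ^ K.card := by
  have h1 : ∀ ω : Sample n d, Real.exp (s * ∑ k ∈ K,
      A k (ω (edg k i).1 (edg k i).2) * B k (ω (edg k j).1 (edg k j).2))
      = ∑ T ∈ K.powerset, (Real.exp s - 1) ^ T.card *
        ∏ z ∈ T ×ˢ (Finset.univ : Finset Bool), (if z.2 then A z.1 else B z.1)
          (ω (edg z.1 (if z.2 then i else j)).1 (edg z.1 (if z.2 then i else j)).2) := by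
    intro ω
    rw [Finset.mul_sum, Real.exp_sum]
    have : ∀ k ∈ K, Real.exp (s * (A k (ω (edg k i).1 (edg k i).2) * B k (ω (edg k j).1 (edg k j).2)))
        = 1 + (Real.exp s - 1) * (A k (ω (edg k i).1 (edg k i).2) * B k (ω (edg k j).1 (edg k j).2)) := by
      intro k _
      rcases hA k (ω (edg k i).1 (edg k i).2) with h | h <;>
      rcases hB k (ω (edg k j).1 (edg k j).2) with h' | h' <;> rw [h, h'] <;> simp
    rw [Finset.prod_congr rfl this, Finset.prod_one_add]
    refine Finset.sum_congr rfl fun T _ => ?_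
    rw [Finset.prod_mul_distrib, Finset.prod_const, Finset.prod_product]
    simp
  simp_rw [h1, Finset.mul_sum]
  rw [Finset.sum_comm]
  have h2 : ∀ T ∈ K.powerset, ∑ ω : Sample n d, wtJOM n d p ω * ((Real.exp s - 1) ^ T.card *
        ∏ z ∈ T ×ˢ (Finset.univ : Finset Bool), (if z.2 then A z.1 else B z.1)
          (ω (edg z.1 (if z.2 then i else j)).1 (edg z.1 (if z.2 then i else j)).2))
      = ∏ k ∈ T, ((Real.exp s - 1) * (x * y)) := by
    intro T hT
    rw [Finset.mem_powerset] at hT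
    have := prod_expect_inj (wE d p) (wE_sum d p) (T ×ˢ (Finset.univ : Finset Bool))
      (fun z : Fin n × Bool => edg z.1 (if z.2 then i else j)) (edg_inj hij T fun k hk => hK k (hT hk))
      (fun z => if z.2 then A z.1 else B z.1)
    simp_rw [mul_left_comm _ ((Real.exp s - 1) ^ T.card)]
    rw [← Finset.mul_sum, Finset.prod_mul_distrib, Finset.prod_const]
    congr 1
    refine this.trans ?_
    rw [Finset.prod_product]
    refine Finset.prod_congr rfl fun k hk => ?_
    rw [Fintype.prod_bool]
    simp [hx k (hT hk), hy k (hT hk)]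
  rw [Finset.sum_congr rfl h2, ← Finset.prod_one_add, Finset.prod_const]

lemma wt_nonneg (n d : ℕ) (p : ℝ) (hp0 : 0 ≤ p) (hp1 : p ≤ 1) (ω : Sample n d) :
    0 ≤ wtJOM n d p ω :=
  Finset.prod_nonneg fun _ _ => Finset.prod_nonneg fun _ _ => wE_nonneg d p hp0 hp1 _

lemma wt_sum (n d : ℕ) (p : ℝ) : ∑ ω : Sample n d, wtJOM n d p ω = 1 := by
  have := prod_expect (ι := Fin n) (wE d p) (fun _ _ _ => 1)
  simp only [wE_sum, mul_one, Finset.prod_const_one] at this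
  exact this

lemma markov (n d : ℕ) (p : ℝ) (hp0 : 0 ≤ p) (hp1 : p ≤ 1) (E : Sample n d → Prop)
    (f : Sample n d → ℝ) (hf : ∀ ω, 0 ≤ f ω) (hE : ∀ ω, E ω → 1 ≤ f ω) :
    prJOM n d p E ≤ ∑ ω, wtJOM n d p ω * f ω := by
  refine Finset.sum_le_sum fun ω _ => ?_
  have h0 := wt_nonneg n d p hp0 hp1 ω
  split_ifs with h
  · nlinarith [hE ω h]
  · exact mul_nonneg h0 (hf ω)

lemma conc (n d : ℕ) (hn : 2 ≤ n) (p : ℝ) (hp0 : 0 ≤ p) (hp1 : p ≤ 1) (i j : Fin n) (hij : i ≠ j)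
    (A B : Fin n → Bool × Equiv.Perm (Fin d) → ℝ)
    (hA : ∀ k x, A k x = 0 ∨ A k x = 1) (hB : ∀ k x, B k x = 0 ∨ B k x = 1)
    (x y : ℝ) (K : Finset (Fin n)) (hK : ∀ k ∈ K, k ≠ i ∧ k ≠ j) (hKc : (K.card : ℝ) = n - 2)
    (hx : ∀ k ∈ K, ∑ z, wE d p z * A k z = x) (hy : ∀ k ∈ K, ∑ z, wE d p z * B k z = y)
    (hxy0 : 0 ≤ x * y) (hxy1 : x * y ≤ 1)
    (ε : ℝ) (hε0 : 0 < ε) (hε1 : ε ≤ 1) (s : ℝ) (hs : |s| = ε / 2) :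
    prJOM n d p (fun ω => |s| * (ε * n) ≤ s * (∑ k ∈ K,
      A k (ω (edg k i).1 (edg k i).2) * B k (ω (edg k j).1 (edg k j).2) - n * (x * y)))
      ≤ Real.exp (1 - n * (ε ^ 2 / 4)) := by
  set S : Sample n d → ℝ := fun ω => ∑ k ∈ K,
      A k (ω (edg k i).1 (edg k i).2) * B k (ω (edg k j).1 (edg k j).2) with hS
  have hm := markov n d p hp0 hp1 (fun ω => |s| * (ε * n) ≤ s * (S ω - n * (x * y)))
    (fun ω => Real.exp (s * S ω) * Real.exp (-(s * (n * (x * y))) - |s| * (ε * n)))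
    (fun ω => by positivity) (fun ω h => by
      rw [← Real.exp_add]
      apply Real.one_le_exp
      linarith)
  refine hm.trans ?_
  have hre : ∀ ω : Sample n d, wtJOM n d p ω * (Real.exp (s * S ω) *
      Real.exp (-(s * (n * (x * y))) - |s| * (ε * n))) = wtJOM n d p ω * Real.exp (s * S ω) *
      Real.exp (-(s * (n * (x * y))) - |s| * (ε * n)) := fun ω => (mul_assoc _ _ _).symm
  rw [Finset.sum_congr rfl fun ω _ => hre ω, ← Finset.sum_mul, mgf_eq n d p i j hij A B hA hB x y K hK hx hy s]
  have hs1 : |s| ≤ 1 := by rw [hs]; linarith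
  have hexp : Real.exp s - 1 ≤ s + s ^ 2 := by
    have := (abs_le.1 (Real.abs_exp_sub_one_sub_id_le hs1)).2
    linarith
  have hsl := abs_le.1 hs1
  have hb : 1 + (Real.exp s - 1) * (x * y) ≤ Real.exp ((s + s ^ 2) * (x * y)) := by
    have := Real.add_one_le_exp ((s + s ^ 2) * (x * y))
    nlinarith
  have hb0 : 0 ≤ 1 + (Real.exp s - 1) * (x * y) := by
    have := Real.exp_pos s
    nlinarith
  calc _ ≤ (Real.exp ((s + s ^ 2) * (x * y))) ^ K.card * Real.exp (-(s * (n * (x * y))) - |s| * (ε * n)) := by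
        exact mul_le_mul_of_nonneg_right (pow_le_pow_left₀ hb0 hb _) (Real.exp_pos _).le
    _ = Real.exp (K.card * ((s + s ^ 2) * (x * y)) + (-(s * (n * (x * y))) - |s| * (ε * n))) := by
        rw [Real.exp_add, Real.exp_nat_mul]
    _ ≤ _ := by
        apply Real.exp_le_exp.2
        rw [hKc]
        have hsq : s ^ 2 = ε ^ 2 / 4 := by rw [← sq_abs, hs]; ring
        have hn' : (2 : ℝ) ≤ n := by exact_mod_cast hn
        rw [hsq, hs]
        have a1 : -(2 * s * (x * y)) ≤ 1 := by
          have : -s ≤ 1 / 2 := by have := neg_abs_le s; linarith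
          nlinarith
        have a2 : (n - 2) * (ε ^ 2 / 4 * (x * y)) ≤ n * (ε ^ 2 / 4) := by
          have : ε ^ 2 / 4 * (x * y) ≤ ε ^ 2 / 4 := mul_le_of_le_one_right (by positivity) hxy1
          have h0 : 0 ≤ ε ^ 2 / 4 * (x * y) := by positivity
          nlinarith
        nlinarith

lemma conc_abs (n d : ℕ) (hn : 2 ≤ n) (p : ℝ) (hp0 : 0 ≤ p) (hp1 : p ≤ 1) (i j : Fin n) (hij : i ≠ j)
    (A B : Fin n → Bool × Equiv.Perm (Fin d) → ℝ)
    (hA : ∀ k x, A k x = 0 ∨ A k x = 1) (hB : ∀ k x, B k x = 0 ∨ B k x = 1)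
    (x y : ℝ) (K : Finset (Fin n)) (hK : ∀ k ∈ K, k ≠ i ∧ k ≠ j) (hKc : (K.card : ℝ) = n - 2)
    (hx : ∀ k ∈ K, ∑ z, wE d p z * A k z = x) (hy : ∀ k ∈ K, ∑ z, wE d p z * B k z = y)
    (hxy0 : 0 ≤ x * y) (hxy1 : x * y ≤ 1)
    (ε : ℝ) (hε0 : 0 < ε) (hε1 : ε ≤ 1) :
    prJOM n d p (fun ω => ¬ |∑ k ∈ K,
      A k (ω (edg k i).1 (edg k i).2) * B k (ω (edg k j).1 (edg k j).2) - n * (x * y)| ≤ ε * n)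
      ≤ 2 * Real.exp (1 - n * (ε ^ 2 / 4)) := by
  have e2 : |ε / 2| = ε / 2 := abs_of_pos (by positivity)
  have c1 := conc n d hn p hp0 hp1 i j hij A B hA hB x y K hK hKc hx hy hxy0 hxy1 ε hε0 hε1 (ε / 2) e2
  have c2 := conc n d hn p hp0 hp1 i j hij A B hA hB x y K hK hKc hx hy hxy0 hxy1 ε hε0 hε1 (-(ε / 2))
    (by rw [abs_neg, e2])
  rw [two_mul]
  refine le_trans ?_ (add_le_add c1 c2)
  unfold prJOM
  rw [← Finset.sum_add_distrib]
  refine Finset.sum_le_sum fun ω _ => ?_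
  have h0 := wt_nonneg n d p hp0 hp1 ω
  rw [abs_neg, e2]
  set D := ∑ k ∈ K,
      A k (ω (edg k i).1 (edg k i).2) * B k (ω (edg k j).1 (edg k j).2) - n * (x * y) with hD
  by_cases hc : |D| ≤ ε * n
  · rw [if_neg (not_not.2 hc)]
    apply add_nonneg <;> split_ifs <;> simp [h0]
  · rw [if_pos hc]
    rw [not_le, lt_abs] at hc
    rcases hc with h | h
    · rw [if_pos (by nlinarith)]
      have : 0 ≤ if ε / 2 * (ε * n) ≤ -(ε / 2) * D then wtJOM n d p ω else 0 := by
        split_ifs <;> simp [h0]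
      linarith
    · rw [if_pos (show ε / 2 * (ε * n) ≤ -(ε / 2) * D by nlinarith)]
      have : 0 ≤ if ε / 2 * (ε * n) ≤ (ε / 2) * D then wtJOM n d p ω else 0 := by
        split_ifs <;> simp [h0]
      linarith

lemma union_bd {κ : Type*} [Fintype κ] (n d : ℕ) (p : ℝ) (hp0 : 0 ≤ p) (hp1 : p ≤ 1)
    (E : κ → Sample n d → Prop) (C : Sample n d → Prop) (c : ℝ)
    (hc : ∀ x, prJOM n d p (fun ω => E x ω) ≤ c) (h : ∀ ω, (∀ x, ¬ E x ω) → C ω) :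
    1 - Fintype.card κ * c ≤ prJOM n d p C ∧ prJOM n d p C ≤ 1 := by
  have hw := wt_nonneg n d p hp0 hp1
  constructor
  · have h1 : 1 ≤ prJOM n d p C + ∑ x : κ, prJOM n d p (fun ω => E x ω) := by
      unfold prJOM
      rw [Finset.sum_comm, ← Finset.sum_add_distrib, ← wt_sum n d p]
      refine Finset.sum_le_sum fun ω _ => ?_
      beta_reduce
      have hnn : ∀ x ∈ (Finset.univ : Finset κ), 0 ≤ if E x ω then wtJOM n d p ω else 0 := by
        intro x _
        split_ifs <;> simp [hw ω]
      by_cases hC : C ω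
      · rw [if_pos hC]
        have := Finset.sum_nonneg hnn
        linarith
      · rw [if_neg hC]
        have : ∃ x, E x ω := by
          by_contra hcon
          push Not at hcon
          exact hC (h ω hcon)
        obtain ⟨x, hx⟩ := this
        have := Finset.single_le_sum hnn (Finset.mem_univ x)
        rw [if_pos hx] at this
        linarith
    have h2 : ∑ x : κ, prJOM n d p (fun ω => E x ω) ≤ Fintype.card κ * c := by
      refine (Finset.sum_le_sum fun x _ => hc x).trans ?_
      simp
    linarith
  · unfold prJOM
    rw [← wt_sum n d p]
    refine Finset.sum_le_sum fun ω _ => ?_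
    split_ifs <;> simp [hw ω]

/-- Entry selector. -/
def ent {d : ℕ} (Y : Matrix (Fin d) (Fin d) ℝ) : Option (Fin d × Fin d) → ℝ
  | none => 1
  | some z => Y z.1 z.2

/-- Mean of the selected entry. -/
def mo (d : ℕ) (p : ℝ) : Option (Fin d × Fin d) → ℝ
  | none => 1
  | some z => mE d p z.1 z.2

/-- Selected entry of the oriented edge matrix. -/
def gA {n : ℕ} (d : ℕ) (i : Fin n) (o : Option (Fin d × Fin d)) (k : Fin n)
    (x : Bool × Equiv.Perm (Fin d)) : ℝ :=
  if k < i then ent (bm d x) o else ent (bm d x)ᵀ o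

lemma gA_01 {n d : ℕ} (i : Fin n) (o : Option (Fin d × Fin d)) (k : Fin n) (x) :
    gA d i o k x = 0 ∨ gA d i o k x = 1 := by
  unfold gA
  cases o with
  | none => right; simp [ent]
  | some z =>
    split_ifs
    · exact bm_01 d x _ _
    · exact bm_01 d x _ _

lemma gA_mean {n d : ℕ} (p : ℝ) (i : Fin n) (o : Option (Fin d × Fin d)) (k : Fin n) :
    ∑ x, wE d p x * gA d i o k x = mo d p o := by
  unfold gA
  cases o with
  | none => simp [ent, mo, wE_sum]
  | some z =>
    split_ifs
    · exact bm_mean d p _ _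
    · exact (bm_mean d p _ _).trans (mE_symm d p _ _)

lemma gA_eq {n d : ℕ} (ω : Sample n d) (i k : Fin n) (hk : k ≠ i) (o : Option (Fin d × Fin d)) :
    ent (XinRand n d ω k i) o = gA d i o k (ω (edg k i).1 (edg k i).2) := by
  unfold gA XinRand edg
  rcases lt_or_gt_of_ne hk with h | h
  · rw [if_pos h, if_pos h, min_eq_left h.le, max_eq_right h.le]; rfl
  · rw [if_neg h.not_gt, if_neg h.not_gt, if_pos h, min_eq_right h.le, max_eq_left h.le]; rfl

lemma mo_bd {d : ℕ} (hd : 2 ≤ d) (p : ℝ) (hp0 : 0 ≤ p) (hp1 : p ≤ 1) (o : Option (Fin d × Fin d)) :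
    0 ≤ mo d p o ∧ mo d p o ≤ 1 := by
  cases o with
  | none => simp [mo]
  | some z =>
    have hd1 : (1 : ℝ) ≤ d := by exact_mod_cast (by omega : 1 ≤ d)
    have h1 : 0 ≤ (1 - p) / d := div_nonneg (by linarith) (by linarith)
    have h2 : (1 - p) / d ≤ 1 - p := div_le_self (by linarith) hd1
    simp only [mo, mE]
    split_ifs <;> constructor <;> linarith

lemma Xin_01 {n d : ℕ} (ω : Sample n d) (i j : Fin n) (t q : Fin d) :
    XinRand n d ω i j t q = 0 ∨ XinRand n d ω i j t q = 1 := by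
  unfold XinRand
  split_ifs
  · exact bm_01 d _ _ _
  · exact bm_01 d _ _ _
  · rw [Matrix.one_apply]; split_ifs <;> simp

lemma Xin_row {n d : ℕ} (ω : Sample n d) (i j : Fin n) (t : Fin d) :
    ∑ q, XinRand n d ω i j t q = 1 := by
  unfold XinRand
  split_ifs
  · exact bm_row d _ _
  · exact bm_col d _ _
  · simp [Matrix.one_apply]

lemma Xin_sym {n d : ℕ} (ω : Sample n d) (i j : Fin n) (t q : Fin d) :
    XinRand n d ω j i t q = XinRand n d ω i j q t := by
  unfold XinRand
  rcases lt_trichotomy i j with h | h | h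
  · rw [if_neg h.not_gt, if_pos h, if_pos h]; rfl
  · subst h
    simp only [lt_irrefl, if_false, Matrix.one_apply, eq_comm]
  · rw [if_pos h, if_neg h.not_gt, if_pos h]; rfl

lemma Xin_col {n d : ℕ} (ω : Sample n d) (i j : Fin n) (q : Fin d) :
    ∑ t, XinRand n d ω i j t q = 1 := by
  rw [← Xin_row ω j i q]
  exact Finset.sum_congr rfl fun t _ => Xin_sym ω j i t q

lemma kappa_symm (n d : ℕ) (a : Fin n → Fin n → Matrix (Fin d) (Fin d) ℝ) (α β : ℝ)
    (hsym : ∀ i j t q, a j i t q = a i j q t) (i j : Fin n) (t : Fin d) :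
    kappaJOM n d a α β i j t = kappaJOM n d a α β j i t := by
  unfold kappaJOM
  have hK : Finset.univ.filter (fun k : Fin n => k ≠ j ∧ k ≠ i)
      = Finset.univ.filter (fun k : Fin n => k ≠ i ∧ k ≠ j) := by
    ext k; simp; tauto
  rw [hK]
  have h1 : ∀ l k, min (a k j l t / α + a k i t t / (β * d)) (a k i l t / α + a k j t t / (β * d))
      = min (a k i l t / α + a k j t t / (β * d)) (a k j l t / α + a k i t t / (β * d)) :=
    fun l k => min_comm _ _
  simp_rw [h1]
  rw [add_comm (∑ k with k ≠ j, a k j t t), hsym i j t t]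
  simp_rw [add_comm (a j i t _)]

lemma whp_bound (n d : ℕ) (hn : 2 ≤ n) (hd : 2 ≤ d) (p α β ε : ℝ)
    (hp0 : 0 ≤ p) (hp1 : p ≤ 1) (hα : 0 < α) (hαβ : α ≤ β) (hA1 : β / (α + β) ≤ p)
    (hε : 15 * ε < α * (2 * (p ^ 2 / β + (1 / α - 1 / β) * p + (1 / 2 - 1 / α))))
    (hdn : (d : ℝ) ≤ ε * n) (hε0 : 0 < ε) (hε1 : ε ≤ 1) :
    1 - (4 * (n : ℝ) ^ 6) * (2 * Real.exp (1 - n * (ε ^ 2 / 4))) ≤ prJOM n d p (fun ω =>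
          ∀ i j : Fin n, i < j → ∀ t q : Fin d,
            (aRand n d ω i j t t = 1 → aRand n d ω i j q q = -1 →
              aRand n d ω i j t q = 1 →
              0 < kappaJOM n d (aRand n d ω) α β i j q +
                  deltaJOM n d (aRand n d ω) α β i j t q +
                  deltaJOM n d (aRand n d ω) α β j i q t) ∧
            (aRand n d ω i j t t = -1 → aRand n d ω i j q q = 1 →
              aRand n d ω i j t q = 1 →
              0 < kappaJOM n d (aRand n d ω) α β i j t +
                  deltaJOM n d (aRand n d ω) α β i j t q +
                  deltaJOM n d (aRand n d ω) α β j i q t)) ∧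
    prJOM n d p (fun ω =>
          ∀ i j : Fin n, i < j → ∀ t q : Fin d,
            (aRand n d ω i j t t = 1 → aRand n d ω i j q q = -1 →
              aRand n d ω i j t q = 1 →
              0 < kappaJOM n d (aRand n d ω) α β i j q +
                  deltaJOM n d (aRand n d ω) α β i j t q +
                  deltaJOM n d (aRand n d ω) α β j i q t) ∧
            (aRand n d ω i j t t = -1 → aRand n d ω i j q q = 1 →
              aRand n d ω i j t q = 1 →
              0 < kappaJOM n d (aRand n d ω) α β i j t +
                  deltaJOM n d (aRand n d ω) α β i j t q +
                  deltaJOM n d (aRand n d ω) α β j i q t)) ≤ 1 := by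
  have U := union_bd (κ := (Fin n × Fin n) × (Option (Fin d × Fin d) × Option (Fin d × Fin d)))
    n d p hp0 hp1
    (fun z ω => z.1.1 ≠ z.1.2 ∧ ¬ |∑ k with k ≠ z.1.1 ∧ k ≠ z.1.2,
      ent (XinRand n d ω k z.1.1) z.2.1 * ent (XinRand n d ω k z.1.2) z.2.2
        - n * (mo d p z.2.1 * mo d p z.2.2)| ≤ ε * n)
    (fun ω =>
          ∀ i j : Fin n, i < j → ∀ t q : Fin d,
            (aRand n d ω i j t t = 1 → aRand n d ω i j q q = -1 →
              aRand n d ω i j t q = 1 →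
              0 < kappaJOM n d (aRand n d ω) α β i j q +
                  deltaJOM n d (aRand n d ω) α β i j t q +
                  deltaJOM n d (aRand n d ω) α β j i q t) ∧
            (aRand n d ω i j t t = -1 → aRand n d ω i j q q = 1 →
              aRand n d ω i j t q = 1 →
              0 < kappaJOM n d (aRand n d ω) α β i j t +
                  deltaJOM n d (aRand n d ω) α β i j t q +
                  deltaJOM n d (aRand n d ω) α β j i q t)) (2 * Real.exp (1 - n * (ε ^ 2 / 4))) ?_ ?_
  · refine ⟨le_trans ?_ U.1, U.2⟩
    have hcard : (Fintype.card ((Fin n × Fin n) × (Option (Fin d × Fin d) × Option (Fin d × Fin d))) : ℝ)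
        ≤ 4 * (n : ℝ) ^ 6 := by
      simp only [Fintype.card_prod, Fintype.card_option, Fintype.card_fin]
      push_cast
      have hd1 : (1 : ℝ) ≤ d := by exact_mod_cast (by omega : 1 ≤ d)
      have hdn' : (d : ℝ) ≤ n := by
        have : (0 : ℝ) ≤ n := by positivity
        nlinarith
      have h1 : (d : ℝ) * d + 1 ≤ 2 * n ^ 2 := by nlinarith
      calc (n : ℝ) * n * ((d * d + 1) * (d * d + 1)) ≤ n * n * ((2 * n ^ 2) * (2 * n ^ 2)) := by gcongr
        _ = 4 * (n : ℝ) ^ 6 := by ring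
    have := mul_le_mul_of_nonneg_right hcard
      (show 0 ≤ 2 * Real.exp (1 - n * (ε ^ 2 / 4)) by positivity)
    linarith
  · rintro ⟨⟨i, j⟩, o, o'⟩
    by_cases hij : i = j
    · simp only [hij, ne_eq, not_true_eq_false, false_and, prJOM, if_false, Finset.sum_const_zero]
      positivity
    · have hKe : Finset.univ.filter (fun k : Fin n => k ≠ i ∧ k ≠ j)
          = (Finset.univ.erase i).erase j := by
        ext k; simp; tauto
      have hji : j ∈ (Finset.univ : Finset (Fin n)).erase i := by simp [Ne.symm hij]
      have cardK : ((Finset.univ.filter (fun k : Fin n => k ≠ i ∧ k ≠ j)).card : ℝ) = n - 2 := by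
        rw [hKe, Finset.card_erase_of_mem hji, Finset.card_erase_of_mem (Finset.mem_univ i),
          Finset.card_univ, Fintype.card_fin, Nat.sub_sub, Nat.cast_sub (by omega)]; norm_num
      have b1 := mo_bd hd p hp0 hp1 o
      have b2 := mo_bd hd p hp0 hp1 o'
      have c := conc_abs n d hn p hp0 hp1 i j hij (gA d i o) (gA d j o') (gA_01 i o) (gA_01 j o')
        (mo d p o) (mo d p o') (Finset.univ.filter (fun k : Fin n => k ≠ i ∧ k ≠ j))
        (fun k hk => by simpa using hk) cardK (fun k _ => gA_mean p i o k)
        (fun k _ => gA_mean p j o' k) (mul_nonneg b1.1 b2.1) (mul_le_one₀ b1.2 b2.1 b2.2) ε hε0 hε1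
      refine le_trans (le_of_eq ?_) c
      congr 1
      funext ω
      simp only [ne_eq, hij, not_false_eq_true, true_and]
      rw [Finset.sum_congr rfl]
      intro k hk
      simp only [Finset.mem_filter, Finset.mem_univ, true_and] at hk
      rw [gA_eq ω i k hk.1, gA_eq ω j k hk.2]
  · intro ω hω
    have hS : ∀ i j : Fin n, i ≠ j → ∀ a b : Fin d,
        |∑ k with k ≠ i ∧ k ≠ j, XinRand n d ω k i a b - n * mE d p a b| ≤ ε * n := by
      intro i j hij a b
      have := hω ((i, j), (some (a, b), none))
      simp only [not_and, not_not] at this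
      simpa [ent, mo] using this hij
    have hD : ∀ i j : Fin n, i ≠ j → ∀ a b c e : Fin d,
        |∑ k with k ≠ i ∧ k ≠ j, XinRand n d ω k i a b * XinRand n d ω k j c e
          - n * (mE d p a b * mE d p c e)| ≤ ε * n := by
      intro i j hij a b c e
      have := hω ((i, j), (some (a, b), some (c, e)))
      simp only [not_and, not_not] at this
      exact this hij
    have ha : ∀ i j t q, aRand n d ω i j t q = 1 - 2 * XinRand n d ω i j t q :=
      fun i j t q => rfl
    have hasym : ∀ i j t q, aRand n d ω j i t q = aRand n d ω i j q t := fun i j t q => by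
      rw [ha, ha, Xin_sym ω i j]
    have key := fun (i j : Fin n) (hij : i ≠ j) => det_lemma n d hn hd (XinRand n d ω) (aRand n d ω)
      ha (Xin_01 ω) (Xin_row ω) (Xin_col ω) (Xin_sym ω) p α β ε hp1 hα hαβ hA1 hε hdn i j hij hS hD
    intro i j hij t q
    constructor
    · intro h1 h2 _
      rw [ha] at h1 h2
      exact key i j hij.ne t q (by linarith) (by linarith)
    · intro h1 h2 _
      rw [ha] at h1 h2
      have := key j i hij.ne' q t (by rw [Xin_sym ω i j]; linarith) (by rw [Xin_sym ω i j]; linarith)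
      rw [kappa_symm n d _ α β hasym i j t]
      linarith

/-- Under the random corruption model, if assumptions (A1) and (A3)–(A6) hold and
`d(n)⁴ log n / n → 0`, then with probability tending to one conditions (C4) and (C5)
hold strictly. -/
theorem C4_C5_strict_whp
    (d : ℕ → ℕ) (hd : ∀ n, 2 ≤ d n)
    (hdo : Filter.Tendsto (fun n : ℕ => (d n : ℝ) ^ 4 * Real.log n / n)
      Filter.atTop (nhds 0))
    (p α β : ℝ) (hp0 : 0 ≤ p) (hp1 : p ≤ 1) (hα : 0 < α) (hαβ : α ≤ β) (hβ2 : β ≤ 2)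
    (hA1 : β / (α + β) ≤ p)
    (hA4 : 0 < p ^ 2 / β + (1 / α - 1 / β) * p + (1 / 2 - 1 / α))
    (hA5 : 1 / 4 ≤ p)
    (hA6 : ∀ᶠ n in Filter.atTop, 12 * d n < n ^ 2) :
    Filter.Tendsto (fun n : ℕ =>
        prJOM n (d n) p (fun ω =>
          ∀ i j : Fin n, i < j → ∀ t q : Fin (d n),
            (aRand n (d n) ω i j t t = 1 → aRand n (d n) ω i j q q = -1 →
              aRand n (d n) ω i j t q = 1 →
              0 < kappaJOM n (d n) (aRand n (d n) ω) α β i j q +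
                  deltaJOM n (d n) (aRand n (d n) ω) α β i j t q +
                  deltaJOM n (d n) (aRand n (d n) ω) α β j i q t) ∧
            (aRand n (d n) ω i j t t = -1 → aRand n (d n) ω i j q q = 1 →
              aRand n (d n) ω i j t q = 1 →
              0 < kappaJOM n (d n) (aRand n (d n) ω) α β i j t +
                  deltaJOM n (d n) (aRand n (d n) ω) α β i j t q +
                  deltaJOM n (d n) (aRand n (d n) ω) α β j i q t)))
      Filter.atTop (nhds 1) := by
  have hβ : 0 < β := lt_of_lt_of_le hα hαβ
  set M := 2 * (p ^ 2 / β + (1 / α - 1 / β) * p + (1 / 2 - 1 / α)) with hM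
  have hMpos : 0 < M := by positivity
  obtain ⟨ε, hε0, hε1, hεM⟩ : ∃ ε : ℝ, 0 < ε ∧ ε ≤ 1 ∧ 15 * ε < α * M := by
    refine ⟨min 1 (α * M / 16), by positivity, min_le_left _ _, ?_⟩
    have := min_le_right 1 (α * M / 16)
    have : 0 < α * M := by positivity
    linarith
  -- eventually d ≤ ε n
  have hev : ∀ᶠ n : ℕ in Filter.atTop, (d n : ℝ) ≤ ε * n := by
    filter_upwards [hdo.eventually (gt_mem_nhds hε0), Filter.eventually_ge_atTop 3] with n hn h3
    have hn3 : (3 : ℝ) ≤ n := by exact_mod_cast h3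
    have hlog : 1 ≤ Real.log n := by
      rw [Real.le_log_iff_exp_le (by linarith)]
      linarith [Real.exp_one_lt_d9]
    rw [div_lt_iff₀ (by linarith)] at hn
    have hd2 : (1 : ℝ) ≤ d n := by exact_mod_cast (by have := hd n; omega : 1 ≤ d n)
    have h4 : (d n : ℝ) ≤ (d n : ℝ) ^ 4 := le_self_pow₀ hd2 (by norm_num)
    nlinarith
  have hlim : Filter.Tendsto (fun n : ℕ => 1 - (4 * (n : ℝ) ^ 6) * (2 * Real.exp (1 - n * (ε ^ 2 / 4))))
      Filter.atTop (nhds 1) := by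
    have hc : 0 < ε ^ 2 / 4 := by positivity
    have h1 := (Real.tendsto_pow_mul_exp_neg_atTop_nhds_zero 6).comp
      ((tendsto_natCast_atTop_atTop (R := ℝ)).atTop_mul_const hc)
    have h2 := (h1.const_mul (8 * Real.exp 1 / (ε ^ 2 / 4) ^ 6)).const_sub 1
    rw [mul_zero, sub_zero] at h2
    refine h2.congr fun n => ?_
    simp only [Function.comp]
    rw [sub_eq_add_neg (1 : ℝ) (n * (ε ^ 2 / 4)), Real.exp_add, mul_pow]
    field_simp
    ring
  have hbd : ∀ n : ℕ, (d n : ℝ) ≤ ε * n ∧ 2 ≤ n → _ ∧ _ := fun n h =>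
    whp_bound n (d n) h.2 (hd n) p α β ε hp0 hp1 hα hαβ hA1 hεM h.1 hε0 hε1
  have hev' := hev.and (Filter.eventually_ge_atTop 2)
  exact tendsto_of_tendsto_of_tendsto_of_le_of_le' hlim tendsto_const_nhds
    (hev'.mono fun n h => (hbd n h).1) (hev'.mono fun n h => (hbd n h).2)

end
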